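/- Let L_n denote the lexicographically least binary de Bruijn sequence of order n. There exist a constant c > 0 and an integer N such that for all n ≥ N, disc(L_n) ≥ c · 2^n · log n / n (logarithm natural). -/

import Mathlib

/-- All binary words of length `n` (`false` = 0, `true` = 1), listed in lexicographic order. -/
def allWords : ℕ → List (List Bool)
  | 0 => [[]]
  | n + 1 => (allWords n).flatMap (fun w => [w ++ [false], w ++ [true]])

/-- The skew of a binary word: number of 0s minus number of 1s. -/
def skew (w : List Bool) : ℤ := (w.map (fun b => if b then (-1 : ℤ) else 1)).sum

/-- The discrepancy of a binary word: the maximum over all (nonempty) initial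
segments of the absolute difference between the number of 0s and of 1s. -/
def disc (w : List Bool) : ℤ :=
  ((List.range w.length).map (fun M => |skew (w.take (M + 1))|)).foldr max 0

/-- `w` contains a run of `k` consecutive 0s. -/
def hasZeroRun (k : ℕ) (w : List Bool) : Prop := List.replicate k false <:+: w

instance (k : ℕ) : DecidablePred (hasZeroRun k) := fun _ => inferInstanceAs (Decidable (_ <:+: _))

/-- Number of binary words of length `n` containing no run of `k` consecutive 0s. -/
def alpha (k n : ℕ) : ℕ := ((allWords n).filter (fun w => !decide (hasZeroRun k w))).length

/-- Sum of the skews of all binary words of length `n` containing no run of `k` consecutive 0s. -/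
def beta (k n : ℕ) : ℤ :=
  (((allWords n).filter (fun w => !decide (hasZeroRun k w))).map skew).sum

/-- Strict lexicographic order on binary words, with 0 < 1. -/
def lexLt (u v : List Bool) : Prop := List.Lex (· < ·) u v

instance : DecidableRel lexLt := fun _ _ => inferInstanceAs (Decidable (List.Lex _ _ _))

/-- Weak lexicographic order on binary words. -/
def lexLe (u v : List Bool) : Prop := lexLt u v ∨ u = v

instance : DecidableRel lexLe := fun _ _ => inferInstanceAs (Decidable (_ ∨ _))

/-- A binary Lyndon word: nonempty and strictly lexicographically smaller than
each of its nontrivial cyclic rotations. -/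
def IsLyndon (w : List Bool) : Prop :=
  w ≠ [] ∧ ∀ i ∈ Finset.Ico 1 w.length, lexLt w (w.rotate i)

instance : DecidablePred IsLyndon := fun _ => inferInstanceAs (Decidable (_ ∧ _))

/-- `ell n k`: the concatenation, in lexicographic order, of all binary Lyndon words of
length `n` whose longest run of consecutive 0s has length exactly `k`. -/
def ell (n k : ℕ) : List Bool :=
  (List.insertionSort lexLe ((allWords n).filter (fun w =>
    decide (IsLyndon w) && decide (hasZeroRun k w) && !decide (hasZeroRun (k + 1) w)))).flatten

/-- `LWord n`: the lexicographically least binary de Bruijn sequence of order `n`, i.e. the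
concatenation, in lexicographic order, of all binary Lyndon words of length dividing `n`. -/
def LWord (n : ℕ) : List Bool :=
  (List.insertionSort lexLe (((List.range (n + 1)).flatMap allWords).filter
    (fun w => decide (IsLyndon w) && decide (w.length ∣ n)))).flatten

/-- The number of occurrences of `0^k` as a subword of `w`. -/
def occCount (k : ℕ) (w : List Bool) : ℕ :=
  ((List.range (w.length + 1)).filter
    (fun i => decide (List.replicate k false <+: w.drop i))).length

/-! ### Lexicographic order -/

theorem lexLt_iff_lt {u v : List Bool} : lexLt u v ↔ u < v := Iff.rfl

theorem lexLe_iff_le {u v : List Bool} : lexLe u v ↔ u ≤ v :=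
  (le_iff_lt_or_eq (a := u) (b := v)).symm

theorem append_lt_append_of_length_eq {u v : List Bool} (s t : List Bool)
    (hl : u.length = v.length) (h : u < v) : u ++ s < v ++ t := by
  induction u generalizing v with
  | nil =>
    cases v with
    | nil => exact absurd h (lt_irrefl _)
    | cons b v => simp at hl
  | cons a u ih =>
    cases v with
    | nil => simp at hl
    | cons b v =>
      simp only [List.cons_append, List.cons_lt_cons_iff] at h ⊢
      exact h.imp_right fun h => ⟨h.1, ih (by simpa using hl) h.2⟩

theorem true_notMem_take_of_le {u v : List Bool} (k : ℕ) (h : u ≤ v) (hv : true ∉ v.take k) :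
    true ∉ u.take k := by
  induction k generalizing u v with
  | zero => simp
  | succ k ih =>
    cases u with
    | nil => simp
    | cons a u =>
      cases v with
      | nil => exact absurd (List.nil_lt_cons a u) (not_lt.2 h)
      | cons b v =>
        simp only [List.take_succ_cons, List.mem_cons, not_or] at hv ⊢
        obtain ⟨hb, hv⟩ := hv
        cases b with
        | true => simp at hb
        | false =>
          rcases h.lt_or_eq with h | h
          · rcases List.cons_lt_cons_iff.1 h with h' | ⟨ha, h'⟩
            · exact absurd h' (by cases a <;> decide)
            · exact ⟨by simp [ha], ih h'.le hv⟩
          · obtain ⟨rfl, rfl⟩ := List.cons_eq_cons.1 h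
            exact ⟨by simp, hv⟩

/-! ### Powers of words -/

/-- The concatenation of `e` copies of `w`. -/
def wordPow (w : List Bool) (e : ℕ) : List Bool := (List.replicate e w).flatten

theorem wordPow_succ (w : List Bool) (e : ℕ) : wordPow w (e + 1) = w ++ wordPow w e := by
  simp [wordPow, List.replicate_succ]

theorem length_wordPow (w : List Bool) (e : ℕ) : (wordPow w e).length = e * w.length := by
  simp [wordPow]

theorem wordPow_cons_append_singleton (a : Bool) (t : List Bool) (e : ℕ) :
    wordPow (a :: t) e ++ [a] = a :: wordPow (t ++ [a]) e := by
  induction e with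
  | zero => simp [wordPow]
  | succ e ih => simp [wordPow_succ, ih]

theorem rotate_wordPow (w : List Bool) (e j : ℕ) :
    (wordPow w e).rotate j = wordPow (w.rotate j) e := by
  induction j generalizing w with
  | zero => simp
  | succ j ih =>
    cases w with
    | nil => simp [wordPow]
    | cons a t =>
      cases e with
      | zero => simp [wordPow]
      | succ e =>
        rw [wordPow_succ, List.cons_append, List.rotate_cons_succ, List.rotate_cons_succ, ← ih,
          wordPow_succ, List.append_assoc, wordPow_cons_append_singleton]
        simp

theorem take_wordPow {w : List Bool} {e : ℕ} (he : 0 < e) {k : ℕ} (hk : k ≤ w.length) :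
    (wordPow w e).take k = w.take k := by
  obtain ⟨e, rfl⟩ := Nat.exists_eq_succ_of_ne_zero he.ne'
  rw [wordPow_succ, List.take_append_of_le_length hk]

theorem wordPow_lt_wordPow {u v : List Bool} {e : ℕ} (he : 0 < e) (hl : u.length = v.length)
    (h : u < v) : wordPow u e < wordPow v e := by
  obtain ⟨e, rfl⟩ := Nat.exists_eq_succ_of_ne_zero he.ne'
  rw [wordPow_succ, wordPow_succ]
  exact append_lt_append_of_length_eq _ _ hl h

theorem eq_wordPow_of_append_comm {w r : List Bool} {e : ℕ} (hl : r.length = e * w.length)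
    (h : r ++ w = w ++ r) : r = wordPow w e := by
  induction e generalizing r with
  | zero => simpa [wordPow] using hl
  | succ e ih =>
    have hw : w <+: r := by
      refine List.prefix_of_prefix_length_le (l₃ := r ++ w) (h ▸ List.prefix_append _ _)
        (List.prefix_append _ _) ?_
      rw [hl]; nlinarith
    obtain ⟨r', rfl⟩ := hw
    rw [wordPow_succ, ← ih]
    · rw [List.length_append] at hl; linarith
    · rw [List.append_assoc] at h; exact List.append_cancel_left h

/-! ### Lyndon words and their conjugates -/

theorem IsLyndon.length_pos {w : List Bool} (hw : IsLyndon w) : 0 < w.length :=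
  List.length_pos_iff.2 hw.1

theorem IsLyndon.lt_rotate {w : List Bool} (hw : IsLyndon w) {i : ℕ} (h0 : 0 < i)
    (hi : i < w.length) : w < w.rotate i :=
  hw.2 i (Finset.mem_Ico.2 ⟨h0, hi⟩)

theorem IsLyndon.le_rotate {w : List Bool} (hw : IsLyndon w) (i : ℕ) : w ≤ w.rotate i := by
  rw [← List.rotate_mod]
  rcases Nat.eq_zero_or_pos (i % w.length) with h | h
  · rw [h, List.rotate_zero]
  · exact (hw.lt_rotate h (Nat.mod_lt _ hw.length_pos)).le

theorem IsLyndon.wordPow_lt_rotate {w : List Bool} (hw : IsLyndon w) {e i : ℕ} (he : 0 < e)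
    (h0 : 0 < i) (hi : i < w.length) : wordPow w e < (wordPow w e).rotate i := by
  rw [rotate_wordPow]
  exact wordPow_lt_wordPow he (by simp) (hw.lt_rotate h0 hi)

theorem IsLyndon.wordPow_le_rotate {w : List Bool} (hw : IsLyndon w) {e : ℕ} (he : 0 < e)
    (i : ℕ) : wordPow w e ≤ (wordPow w e).rotate i := by
  rw [rotate_wordPow]
  rcases (hw.le_rotate i).lt_or_eq with h | h
  · exact (wordPow_lt_wordPow he (by simp) h).le
  · rw [← h]

theorem IsLyndon.eq_of_isRotated_wordPow {w w' : List Bool} (hw : IsLyndon w)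
    (hw' : IsLyndon w') {e e' : ℕ} (he : 0 < e) (he' : 0 < e')
    (h : (wordPow w e) ~r (wordPow w' e')) : w = w' := by
  have hp : wordPow w e = wordPow w' e' := by
    obtain ⟨i', hi'⟩ := h.symm
    obtain ⟨i, hi⟩ := h
    exact le_antisymm (hi ▸ hw.wordPow_le_rotate he i) (hi' ▸ hw'.wordPow_le_rotate he' i')
  have key : ∀ {w w' : List Bool} {e e' : ℕ}, IsLyndon w → IsLyndon w' → 0 < e' →
      wordPow w e = wordPow w' e' → ¬ w.length < w'.length := by
    intro w w' e e' hw hw' he' hp hlt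
    have h1 := hw'.wordPow_lt_rotate he' hw.length_pos hlt
    rw [← hp, rotate_wordPow, List.rotate_length] at h1
    exact lt_irrefl _ h1
  have hl : w.length = w'.length :=
    le_antisymm (not_lt.1 (key hw' hw he hp.symm)) (not_lt.1 (key hw hw' he' hp))
  rw [← List.take_length (l := w), ← List.take_length (l := w'), ← take_wordPow he le_rfl,
    ← take_wordPow he' le_rfl, hp, hl]

theorem IsLyndon.rotate_wordPow_injOn {w : List Bool} (hw : IsLyndon w) {e : ℕ} (he : 0 < e) :
    Set.InjOn (fun j => (wordPow w e).rotate j) (Set.Iio w.length) := by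
  have key : ∀ {i j : ℕ}, i < j → j < w.length →
      (wordPow w e).rotate i ≠ (wordPow w e).rotate j := by
    intro i j hij hj h
    have h1 := hw.wordPow_lt_rotate he (Nat.sub_pos_of_lt hij) (i := j - i) (by omega)
    refine h1.ne (List.rotate_injective i ?_)
    simp only [List.rotate_rotate]
    rw [h, Nat.sub_add_cancel hij.le]
  intro i hi j hj h
  rcases lt_trichotomy i j with hij | hij | hij
  · exact absurd h (key hij hj)
  · exact hij
  · exact absurd h.symm (key hij hi)

theorem exists_wordPow_eq_of_le_rotate {m : List Bool} (hm : m ≠ [])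
    (hmin : ∀ i, m ≤ m.rotate i) :
    ∃ w, IsLyndon w ∧ w.length ∣ m.length ∧ m = wordPow w (m.length / w.length) := by
  have hn : 0 < m.length := List.length_pos_iff.2 hm
  have hex : ∃ d, 0 < d ∧ m.rotate d = m := ⟨m.length, hn, m.rotate_length⟩
  classical
  set d := Nat.find hex with hd
  obtain ⟨hd0, hdm⟩ := Nat.find_spec hex
  rw [← hd] at hd0 hdm
  have hlt : ∀ i, 0 < i → i < d → m.rotate i ≠ m := fun i h0 hi h => Nat.find_min hex hi ⟨h0, h⟩
  have hmul : ∀ q, m.rotate (d * q) = m := by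
    intro q
    induction q with
    | zero => simp
    | succ q ih => rw [Nat.mul_succ, ← List.rotate_rotate, ih, hdm]
  have hdvd : d ∣ m.length := by
    rw [Nat.dvd_iff_mod_eq_zero]
    by_contra h
    refine hlt _ (Nat.pos_of_ne_zero h) (Nat.mod_lt _ hd0) ?_
    conv_rhs => rw [← m.rotate_length, ← Nat.div_add_mod m.length d, ← List.rotate_rotate, hmul]
  have hle : d ≤ m.length := Nat.le_of_dvd hn hdvd
  have hlen : (m.take d).length = d := by simp [hle]
  obtain ⟨e, he⟩ := hdvd
  have hpow : m = wordPow (m.take d) (m.length / d) := by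
    rw [he, Nat.mul_div_cancel_left _ hd0]
    have he0 : e ≠ 0 := by rintro rfl; omega
    obtain ⟨e, rfl⟩ := Nat.exists_eq_succ_of_ne_zero he0
    have hdrop : m.drop d = wordPow (m.take d) e := by
      apply eq_wordPow_of_append_comm
      · rw [hlen, List.length_drop, he, Nat.mul_succ, Nat.add_sub_cancel, mul_comm]
      · rw [List.take_append_drop, ← List.rotate_eq_drop_append_take hle, hdm]
    rw [wordPow_succ, ← hdrop, List.take_append_drop]
  refine ⟨m.take d, ⟨?_, ?_⟩, by rw [hlen]; exact ⟨e, he⟩, by rw [hlen]; exact hpow⟩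
  · intro h; rw [h] at hlen; simp at hlen; omega
  · intro i hi
    rw [Finset.mem_Ico, hlen] at hi
    rw [lexLt_iff_lt]
    have he0 : 0 < m.length / d := Nat.div_pos hle hd0
    refine lt_of_le_of_ne (not_lt.1 fun h => ?_) fun h => ?_
    · have h1 := wordPow_lt_wordPow he0 (by simp) h
      rw [← rotate_wordPow, ← hpow] at h1
      exact absurd (hmin i) (not_le.2 h1)
    · refine hlt i (by omega) hi.2 ?_
      rw [hpow, rotate_wordPow, ← h]

theorem exists_isLyndon_rotate_wordPow_eq {x : List Bool} (hx : x ≠ []) :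
    ∃ w, IsLyndon w ∧ w.length ∣ x.length ∧
      ∃ j < w.length, (wordPow w (x.length / w.length)).rotate j = x := by
  have hn : 0 < x.length := List.length_pos_iff.2 hx
  obtain ⟨j, hj, hmin⟩ := Finset.exists_min_image (Finset.range x.length) (fun j => x.rotate j)
    ⟨0, by simpa using hn⟩
  obtain ⟨w, hw, hdvd, h⟩ := exists_wordPow_eq_of_le_rotate (m := x.rotate j)
    (by simpa using hx) (fun i => by
      rw [List.rotate_rotate, ← List.rotate_mod x (j + i)]
      exact hmin _ (Finset.mem_range.2 (Nat.mod_lt _ hn)))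
  rw [List.length_rotate] at hdvd h
  refine ⟨w, hw, hdvd, (x.length - j) % w.length, Nat.mod_lt _ hw.length_pos, ?_⟩
  rw [rotate_wordPow, List.rotate_mod, ← rotate_wordPow, ← h, List.rotate_rotate,
    Nat.add_sub_cancel' (Finset.mem_range.1 hj).le, List.rotate_length]

/-! ### Cyclic runs of zeros -/

/-- Some conjugate of `x` starts with `k` zeros (or consists only of zeros). -/
def HasCyclicZeroRun (k : ℕ) (x : List Bool) : Prop := ∃ i, true ∉ (x.rotate i).take k

theorem IsLyndon.hasCyclicZeroRun_rotate_wordPow_iff {w : List Bool} (hw : IsLyndon w) {e : ℕ}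
    (he : 0 < e) (k j : ℕ) :
    HasCyclicZeroRun k ((wordPow w e).rotate j) ↔ true ∉ w.take k := by
  constructor
  · rintro ⟨i, hi⟩
    rw [List.rotate_rotate, rotate_wordPow] at hi
    refine true_notMem_take_of_le k (hw.le_rotate (j + i)) fun h => hi ?_
    obtain ⟨e, rfl⟩ := Nat.exists_eq_succ_of_ne_zero he.ne'
    rw [wordPow_succ]
    exact ((List.prefix_append _ _).take k).subset h
  · intro h
    obtain ⟨i, hi⟩ := List.IsRotated.symm ⟨j, rfl⟩ (l := wordPow w e)
    refine ⟨i, ?_⟩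
    rw [hi]
    rcases le_total k w.length with hk | hk
    · rwa [take_wordPow he hk]
    · rw [List.take_of_length_le hk] at h
      intro h'
      have := List.mem_of_mem_take h'
      simp [wordPow, h] at this

theorem HasCyclicZeroRun.hasZeroRun_of_cons_true {k : ℕ} (hk : 0 < k) {v : List Bool}
    (h : HasCyclicZeroRun k (true :: v)) : hasZeroRun k v := by
  obtain ⟨i, hi⟩ := h
  rw [← List.rotate_mod] at hi
  have hlt : i % (true :: v).length < (true :: v).length := Nat.mod_lt _ (by simp)
  generalize i % (true :: v).length = i at hi hlt
  cases i with
  | zero =>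
    obtain ⟨k, rfl⟩ := Nat.exists_eq_succ_of_ne_zero hk.ne'
    simp at hi
  | succ i =>
    rw [List.rotate_eq_drop_append_take hlt.le, List.drop_succ_cons, List.take_succ_cons] at hi
    have hlen : k ≤ (v.drop i).length := by
      by_contra! h
      refine hi ?_
      rw [List.take_append, List.mem_append]
      right
      obtain ⟨c, hc⟩ := Nat.exists_eq_succ_of_ne_zero (Nat.sub_pos_of_lt h).ne'
      rw [hc, List.take_succ_cons]
      exact List.mem_cons_self
    rw [List.take_append_of_le_length hlen] at hi
    have heq : (v.drop i).take k = List.replicate k false :=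
      List.eq_replicate_iff.2 ⟨by simpa using hlen, fun b hb => by
        cases b with
        | false => rfl
        | true => exact absurd hb hi⟩
    rw [hasZeroRun, ← heq]
    exact (List.take_prefix _ _).isInfix.trans (List.drop_suffix _ _).isInfix

theorem hasZeroRun_append_true_cons {k : ℕ} {p q : List Bool}
    (h : hasZeroRun k (p ++ true :: q)) : hasZeroRun k p ∨ hasZeroRun k q := by
  by_cases hk : k = 0
  · subst hk; left; exact List.nil_infix
  rcases List.infix_append_iff.1 h with h | h | ⟨l₁, l₂, hl, h₁, h₂⟩
  · exact Or.inl h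
  · rcases List.infix_cons_iff.1 h with h | h
    · obtain ⟨k, rfl⟩ := Nat.exists_eq_succ_of_ne_zero hk
      simp [List.replicate_succ] at h
    · exact Or.inr h
  · rcases List.prefix_cons_iff.1 h₂ with rfl | ⟨t, rfl, -⟩
    · left
      rw [List.append_nil] at hl
      rw [hasZeroRun, hl]; exact h₁.isInfix
    · have : true ∈ List.replicate k false := hl ▸ by simp
      simp at this

theorem not_hasZeroRun_replicate {k c : ℕ} (h : c < k) : ¬ hasZeroRun k (List.replicate c false) :=
  fun h' => by
    have := h'.length_le
    simp at this
    omega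

theorem HasCyclicZeroRun.of_hasZeroRun {k : ℕ} {x : List Bool} (h : hasZeroRun k x) :
    HasCyclicZeroRun k x := by
  obtain ⟨s, t, rfl⟩ := h
  refine ⟨s.length, ?_⟩
  rw [List.append_assoc, List.rotate_append_length_eq, List.append_assoc]
  rw [List.take_append_of_le_length (by simp)]
  simp

/-! ### Enumerating words -/

theorem mem_allWords {n : ℕ} {w : List Bool} : w ∈ allWords n ↔ w.length = n := by
  induction n generalizing w with
  | zero => simp [allWords]
  | succ n ih =>
    simp only [allWords, List.mem_flatMap, List.mem_cons, List.not_mem_nil, or_false, ih]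
    constructor
    · rintro ⟨v, rfl, rfl | rfl⟩ <;> simp
    · intro h
      have hne : w ≠ [] := by rintro rfl; simp at h
      refine ⟨w.dropLast, by simp [h], ?_⟩
      have := List.dropLast_append_getLast hne
      rcases hb : w.getLast hne with _ | _ <;> rw [hb] at this <;> simp [this]

theorem nodup_allWords (n : ℕ) : (allWords n).Nodup := by
  induction n with
  | zero => simp [allWords]
  | succ n ih =>
    rw [allWords, List.nodup_flatMap]
    refine ⟨fun w _ => by simp, ih.imp ?_⟩
    intro u v huv x hu hv
    simp only [List.mem_cons, List.not_mem_nil, or_false] at hu hv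
    apply huv
    rcases hu with rfl | rfl <;> rcases hv with h | h <;>
      exact (List.append_inj' h rfl).1

theorem length_allWords (n : ℕ) : (allWords n).length = 2 ^ n := by
  induction n with
  | zero => simp [allWords]
  | succ n ih => simp [allWords, List.length_flatMap, ih, pow_succ]

/-- The finite set of binary words of length `n`. -/
def words (n : ℕ) : Finset (List Bool) := (allWords n).toFinset

theorem mem_words {n : ℕ} {w : List Bool} : w ∈ words n ↔ w.length = n := by
  simp [words, mem_allWords]

theorem card_words (n : ℕ) : (words n).card = 2 ^ n := by
  rw [words, List.toFinset_card_of_nodup (nodup_allWords n), length_allWords]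

theorem words_succ (n : ℕ) :
    words (n + 1) = (words n).image (List.cons false) ∪ (words n).image (List.cons true) := by
  ext x
  cases x with
  | nil => simp [mem_words]
  | cons b v => cases b <;> simp [mem_words]

/-! ### Words without long runs of zeros -/

theorem card_hasZeroRun_mul_le {k : ℕ} (hk : 0 < k) (m : ℕ) :
    ((words m).filter (hasZeroRun k)).card * 2 ^ k ≤ m * 2 ^ m := by
  induction m with
  | zero =>
    have : (words 0).filter (hasZeroRun k) = ∅ := by
      refine Finset.filter_eq_empty_iff.2 fun x hx h => ?_
      have := h.length_le
      rw [mem_words.1 hx, List.length_replicate] at this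
      omega
    simp [this]
  | succ m ih =>
    have hsub : (words (m + 1)).filter (hasZeroRun k) ⊆
        (((words m).filter (hasZeroRun k)).image (List.cons false) ∪
          ((words m).filter (hasZeroRun k)).image (List.cons true)) ∪
        (words (m + 1)).filter (List.replicate k false <+: ·) := by
      intro x hx
      rw [Finset.mem_filter] at hx
      cases x with
      | nil => simp [mem_words] at hx
      | cons b v =>
        rcases List.infix_cons_iff.1 hx.2 with h | h
        · exact Finset.mem_union_right _ (Finset.mem_filter.2 ⟨hx.1, h⟩)
        · have hv : v ∈ (words m).filter (hasZeroRun k) :=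
            Finset.mem_filter.2 ⟨mem_words.2 (by simpa using mem_words.1 hx.1), h⟩
          apply Finset.mem_union_left
          cases b
          · exact Finset.mem_union_left _ (Finset.mem_image_of_mem _ hv)
          · exact Finset.mem_union_right _ (Finset.mem_image_of_mem _ hv)
    have hpre : ((words (m + 1)).filter (List.replicate k false <+: ·)).card * 2 ^ k ≤
        2 ^ (m + 1) := by
      by_cases hkm : k ≤ m + 1
      · have h1 : (words (m + 1)).filter (List.replicate k false <+: ·) ⊆
            (words (m + 1 - k)).image (List.replicate k false ++ ·) := by
          intro x hx
          obtain ⟨hx, t, rfl⟩ := Finset.mem_filter.1 hx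
          refine Finset.mem_image.2 ⟨t, mem_words.2 ?_, rfl⟩
          have := mem_words.1 hx
          simp at this
          omega
        calc _ ≤ 2 ^ (m + 1 - k) * 2 ^ k := by
              gcongr
              rw [← card_words]
              exact (Finset.card_le_card h1).trans Finset.card_image_le
          _ = 2 ^ (m + 1) := by rw [← pow_add, Nat.sub_add_cancel hkm]
      · have h1 : (words (m + 1)).filter (List.replicate k false <+: ·) = ∅ := by
          refine Finset.filter_eq_empty_iff.2 fun x hx h => ?_
          have := h.length_le
          rw [mem_words.1 hx, List.length_replicate] at this
          omega
        simp [h1]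
    have h2 := (Finset.card_le_card hsub).trans (Finset.card_union_le _ _)
    have h3 := Finset.card_union_le (((words m).filter (hasZeroRun k)).image (List.cons false))
      (((words m).filter (hasZeroRun k)).image (List.cons true))
    have h4 : (((words m).filter (hasZeroRun k)).image (List.cons false)).card ≤
      ((words m).filter (hasZeroRun k)).card := Finset.card_image_le
    have h5 : (((words m).filter (hasZeroRun k)).image (List.cons true)).card ≤
      ((words m).filter (hasZeroRun k)).card := Finset.card_image_le
    calc _ ≤ (2 * ((words m).filter (hasZeroRun k)).card +
          ((words (m + 1)).filter (List.replicate k false <+: ·)).card) * 2 ^ k := by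
            gcongr; omega
      _ ≤ 2 * (m * 2 ^ m) + 2 ^ (m + 1) := by rw [add_mul, mul_assoc]; gcongr
      _ = (m + 1) * 2 ^ (m + 1) := by ring

theorem replicate_append_true_cons_inj {c c' : ℕ} {s s' : List Bool}
    (h : List.replicate c false ++ true :: s = List.replicate c' false ++ true :: s') :
    c = c' ∧ s = s' := by
  induction c generalizing c' with
  | zero =>
    cases c' with
    | zero => simpa using h
    | succ c' => simp [List.replicate_succ] at h
  | succ c ih =>
    cases c' with
    | zero => simp [List.replicate_succ] at h
    | succ c' =>
      simp only [List.replicate_succ, List.cons_append, List.cons.injEq, true_and] at h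
      simpa using ih h

open Classical in
/-- Words `v` for which prepending a `0` creates the only cyclic runs of `k` zeros. -/
theorem mul_card_not_hasZeroRun_le {k : ℕ} (m : ℕ) :
    k * ((words m).filter (¬ hasZeroRun k ·)).card ≤
      ((words (k + 1 + m)).filter
        fun v => HasCyclicZeroRun k (false :: v) ∧ ¬ hasZeroRun k v).card := by
  rw [← Finset.card_range k, ← Finset.card_product, Finset.card_range]
  refine Finset.card_le_card_of_injOn (fun p => List.replicate p.1 false ++
    true :: (p.2 ++ true :: List.replicate (k - 1 - p.1) false)) ?_ ?_
  · rintro ⟨c, y⟩ h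
    simp only [Finset.coe_product, Finset.coe_filter, Set.mem_prod, Finset.mem_coe,
      Finset.mem_range, Set.mem_ofPred_eq, mem_words] at h ⊢
    obtain ⟨hc, rfl, hy⟩ := h
    refine ⟨by simp; omega, ?_, fun h => ?_⟩
    · have hrot : ((false :: (List.replicate c false ++ true :: y ++ [true])) ++
          List.replicate (k - 1 - c) false).rotate (c + y.length + 3) =
          List.replicate k false ++ (true :: y ++ [true]) := by
        have hk : k = (k - 1 - c) + (c + 1) := by omega
        have hlen : c + y.length + 3 =
            (false :: (List.replicate c false ++ true :: y ++ [true])).length := by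
          simp; omega
        rw [hlen, List.rotate_append_length_eq]
        conv_rhs => rw [hk, List.replicate_add, List.replicate_succ]
        simp
      refine ⟨c + y.length + 3, ?_⟩
      have hx : false :: (List.replicate c false ++
          true :: (y ++ true :: List.replicate (k - 1 - c) false)) =
          (false :: (List.replicate c false ++ true :: y ++ [true])) ++
          List.replicate (k - 1 - c) false := by simp
      rw [hx, hrot, List.take_append_of_le_length (by simp)]
      simp
    · rcases hasZeroRun_append_true_cons h with h | h
      · exact not_hasZeroRun_replicate hc h
      · rcases hasZeroRun_append_true_cons h with h | h
        · exact hy h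
        · exact not_hasZeroRun_replicate (by omega) h
  · rintro ⟨c, y⟩ - ⟨c', y'⟩ - h
    obtain ⟨rfl, h⟩ := replicate_append_true_cons_inj h
    exact congrArg (Prod.mk c) (List.append_cancel_right h)

/-! ### Skew -/

/-- The contribution of an (optional) letter to the skew. -/
def letterSign (o : Option Bool) : ℤ := o.elim 0 fun b => if b then -1 else 1

theorem skew_eq_sum (w : List Bool) : skew w = ∑ j ∈ Finset.range w.length, letterSign w[j]? := by
  induction w with
  | nil => simp [skew]
  | cons b w ih =>
    rw [List.length_cons, Finset.sum_range_succ']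
    simp only [List.getElem?_cons_succ, ← ih, List.getElem?_cons_zero]
    simp [skew, letterSign, add_comm]

theorem skew_flatten (l : List (List Bool)) : skew l.flatten = (l.map skew).sum := by
  induction l with
  | nil => simp [skew]
  | cons w l ih =>
    rw [List.flatten_cons, List.map_cons, List.sum_cons, ← ih]
    simp [skew]

theorem le_foldr_max {l : List ℤ} {a : ℤ} (h : a ∈ l) : a ≤ l.foldr max 0 := by
  induction l with
  | nil => simp at h
  | cons b l ih =>
    rcases List.mem_cons.1 h with rfl | h
    · exact le_max_left _ _
    · exact (ih h).trans (le_max_right _ _)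

theorem foldr_max_nonneg (l : List ℤ) : 0 ≤ l.foldr max 0 := by
  cases l with
  | nil => simp
  | cons b l => exact (foldr_max_nonneg l).trans (le_max_right _ _)

theorem skew_le_disc_of_prefix {p w : List Bool} (h : p <+: w) : skew p ≤ disc w := by
  rcases List.eq_nil_or_concat p with rfl | ⟨q, b, hq⟩
  · exact foldr_max_nonneg _
  · have hlen : p.length = q.length + 1 := by simp [hq]
    have hle := h.length_le
    have htake : w.take (q.length + 1) = p := by
      rw [← hlen]; exact (List.prefix_iff_eq_take.1 h).symm
    refine (le_abs_self _).trans (le_foldr_max (List.mem_map.2 ⟨q.length, ?_, ?_⟩))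
    · rw [List.mem_range]; omega
    · rw [htake]

open Classical in
theorem card_le_sum_letterSign {k : ℕ} (hk : 0 < k) (n : ℕ) :
    (((words n).filter
        fun v => HasCyclicZeroRun k (false :: v) ∧ ¬ hasZeroRun k v).card : ℤ) ≤
      ∑ x ∈ (words (n + 1)).filter (HasCyclicZeroRun k), letterSign x.head? := by
  have hdisj : Disjoint ((words n).image (List.cons false)) ((words n).image (List.cons true)) := by
    rw [Finset.disjoint_left]
    intro x h h'
    obtain ⟨v, -, rfl⟩ := Finset.mem_image.1 h
    simp at h'
  rw [Finset.sum_filter, words_succ, Finset.sum_union hdisj,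
    Finset.sum_image (by simp), Finset.sum_image (by simp),
    ← Finset.sum_add_distrib, Finset.card_filter, Nat.cast_sum]
  refine Finset.sum_le_sum fun v _ => ?_
  have h1 : HasCyclicZeroRun k (true :: v) → hasZeroRun k v := fun h => h.hasZeroRun_of_cons_true hk
  have h2 : hasZeroRun k v → HasCyclicZeroRun k (false :: v) := fun h =>
    .of_hasZeroRun (h.trans (List.suffix_cons _ _).isInfix)
  by_cases a1 : HasCyclicZeroRun k (true :: v) <;> by_cases a2 : hasZeroRun k v <;>
    by_cases a3 : HasCyclicZeroRun k (false :: v) <;> simp_all [letterSign]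

/-! ### Prefixes of the least de Bruijn word -/

theorem filter_prefix_of_pairwise {α : Type*} {R : α → α → Prop} {p : α → Bool} {l : List α}
    (hl : l.Pairwise R) (hp : ∀ a b, R a b → p b = true → p a = true) : l.filter p <+: l := by
  induction hl with
  | nil => simp
  | @cons a l ha _ ih =>
    by_cases h : p a = true
    · rw [List.filter_cons_of_pos h]
      exact List.prefix_cons_inj a |>.2 ih
    · have : (a :: l).filter p = [] := by
        rw [List.filter_eq_nil_iff]
        intro b hb hpb
        rcases List.mem_cons.1 hb with rfl | hb
        · exact h hpb
        · exact h (hp a b (ha b hb) hpb)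
      rw [this]
      exact List.nil_prefix

theorem pairwise_insertionSort_lexLe (l : List (List Bool)) :
    (List.insertionSort lexLe l).Pairwise lexLe := by
  have : Std.Total lexLe := ⟨fun u v => by
    rw [lexLe_iff_le, lexLe_iff_le]; exact le_total u v⟩
  have : IsTrans (List Bool) lexLe := ⟨fun u v w => by
    rw [lexLe_iff_le, lexLe_iff_le, lexLe_iff_le]; exact le_trans⟩
  exact List.pairwise_insertionSort lexLe l

/-- The binary Lyndon words whose length divides `n`. -/
def lyndonWords (n : ℕ) : Finset (List Bool) :=
  (((List.range (n + 1)).flatMap allWords).filter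
    fun w => decide (IsLyndon w) && decide (w.length ∣ n)).toFinset

theorem mem_lyndonWords {n : ℕ} (hn : 0 < n) {w : List Bool} :
    w ∈ lyndonWords n ↔ IsLyndon w ∧ w.length ∣ n := by
  simp only [lyndonWords, List.mem_toFinset, List.mem_filter, List.mem_flatMap, List.mem_range,
    mem_allWords, Bool.and_eq_true, decide_eq_true_eq, and_iff_right_iff_imp]
  exact fun h => ⟨_, Nat.lt_succ_of_le (Nat.le_of_dvd hn h.2), rfl⟩

theorem sum_skew_le_disc_LWord (n k : ℕ) :
    ∑ w ∈ (lyndonWords n).filter (true ∉ ·.take k), skew w ≤ disc (LWord n) := by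
  set l := ((List.range (n + 1)).flatMap allWords).filter
    fun w => decide (IsLyndon w) && decide (w.length ∣ n) with hl
  have hnodup : l.Nodup := by
    refine List.Nodup.filter _ (List.nodup_flatMap.2 ⟨fun i _ => nodup_allWords i, ?_⟩)
    refine List.nodup_range.imp ?_
    intro i j hij w hi hj
    exact hij ((mem_allWords.1 hi).symm.trans (mem_allWords.1 hj))
  set p : List Bool → Bool := fun w => decide (true ∉ w.take k)
  have hpre : (List.insertionSort lexLe l).filter p <+: List.insertionSort lexLe l := by
    refine filter_prefix_of_pairwise (pairwise_insertionSort_lexLe l) fun u v huv hv => ?_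
    simp only [p, decide_eq_true_eq] at hv ⊢
    exact true_notMem_take_of_le k (lexLe_iff_le.1 huv) hv
  have hskew := skew_le_disc_of_prefix (p := ((List.insertionSort lexLe l).filter p).flatten)
    (w := LWord n) (by
      obtain ⟨t, ht⟩ := hpre
      refine ⟨t.flatten, ?_⟩
      rw [← List.flatten_append, ht]
      rfl)
  rw [skew_flatten, (((List.perm_insertionSort lexLe l).filter p).map skew).sum_eq] at hskew
  rw [← List.sum_toFinset _ (hnodup.filter p), List.toFinset_filter] at hskew
  simpa [p, lyndonWords, ← hl] using hskew

open Classical in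
theorem sum_skew_lyndonWords {n : ℕ} (hn : 0 < n) (k : ℕ) :
    ∑ w ∈ (lyndonWords n).filter (true ∉ ·.take k), skew w =
      ∑ x ∈ (words n).filter (HasCyclicZeroRun k), letterSign x.head? := by
  simp only [skew_eq_sum]
  rw [Finset.sum_sigma']
  have hpos : ∀ {w : List Bool}, IsLyndon w → w.length ∣ n → 0 < n / w.length :=
    fun hw hd => Nat.div_pos (Nat.le_of_dvd hn hd) hw.length_pos
  refine Finset.sum_nbij (fun q => (wordPow q.1 (n / q.1.length)).rotate q.2) ?_ ?_ ?_ ?_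
  · rintro ⟨w, j⟩ h
    simp only [Finset.mem_sigma, Finset.mem_filter, mem_lyndonWords hn, Finset.mem_range,
      mem_words] at h ⊢
    obtain ⟨⟨⟨hw, hd⟩, hk⟩, hj⟩ := h
    refine ⟨?_, (hw.hasCyclicZeroRun_rotate_wordPow_iff (hpos hw hd) k j).2 hk⟩
    rw [List.length_rotate, length_wordPow, Nat.div_mul_cancel hd]
  · rintro ⟨w, j⟩ h ⟨w', j'⟩ h' heq
    simp only [Finset.mem_coe, Finset.mem_sigma, Finset.mem_filter, mem_lyndonWords hn,
      Finset.mem_range] at h h' heq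
    obtain ⟨⟨⟨hw, hd⟩, -⟩, hj⟩ := h
    obtain ⟨⟨⟨hw', hd'⟩, -⟩, hj'⟩ := h'
    obtain rfl : w = w' := by
      refine hw.eq_of_isRotated_wordPow hw' (hpos hw hd) (hpos hw' hd') ?_
      exact List.IsRotated.trans ⟨j, heq⟩ (List.IsRotated.symm ⟨j', rfl⟩)
    obtain rfl := hw.rotate_wordPow_injOn (hpos hw hd) hj hj' heq
    rfl
  · intro x hx
    simp only [Finset.mem_coe, Finset.mem_filter, mem_words] at hx
    obtain ⟨rfl, hx⟩ := hx
    obtain ⟨w, hw, hd, j, hj, hwx⟩ := exists_isLyndon_rotate_wordPow_eq (List.length_pos_iff.1 hn)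
    refine ⟨⟨w, j⟩, ?_, hwx⟩
    simp only [Finset.mem_coe, Finset.mem_sigma, Finset.mem_filter, mem_lyndonWords hn,
      Finset.mem_range]
    refine ⟨⟨⟨hw, hd⟩, ?_⟩, hj⟩
    rwa [← hw.hasCyclicZeroRun_rotate_wordPow_iff (hpos hw hd) k j, hwx]
  · rintro ⟨w, j⟩ h
    simp only [Finset.mem_sigma, Finset.mem_filter, mem_lyndonWords hn, Finset.mem_range] at h
    obtain ⟨⟨⟨hw, hd⟩, hk⟩, hj⟩ := h
    obtain ⟨e, he⟩ := Nat.exists_eq_succ_of_ne_zero (hpos hw hd).ne'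
    have hne : w.rotate j ≠ [] := by simpa using hw.1
    simp only [he, rotate_wordPow]
    rw [wordPow_succ, List.head?_append_of_ne_nil _ hne, List.head?_rotate hj]

/-! ### The lower bound -/

theorem mul_card_le_disc_LWord {k : ℕ} (hk : 0 < k) (m : ℕ) :
    ((k * ((words m).filter (¬ hasZeroRun k ·)).card : ℕ) : ℤ) ≤ disc (LWord (k + 2 + m)) := by
  classical
  have h := (card_le_sum_letterSign hk (k + 1 + m)).trans_eq
    (sum_skew_lyndonWords (Nat.succ_pos _) k).symm
  have h' := h.trans (sum_skew_le_disc_LWord _ k)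
  rw [show k + 2 + m = k + 1 + m + 1 by omega]
  exact (Nat.cast_le.2 (mul_card_not_hasZeroRun_le m)).trans h'

theorem two_pow_le_two_mul_card {k m : ℕ} (hk : 0 < k) (h : 2 * m ≤ 2 ^ k) :
    2 ^ m ≤ 2 * ((words m).filter (¬ hasZeroRun k ·)).card := by
  have h1 := card_hasZeroRun_mul_le hk m
  have h2 := Finset.card_filter_add_card_filter_not (s := words m) (hasZeroRun k)
  rw [card_words] at h2
  have h3 : 2 * ((words m).filter (hasZeroRun k)).card ≤ 2 ^ m := by
    refine Nat.le_of_mul_le_mul_right ?_ (pow_pos (two_pos : 0 < 2) k)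
    nlinarith [Nat.mul_le_mul_right (2 ^ m) h]
  omega

/-- Lower bound: `disc(L_n) ≥ c · 2^n · log n / n` for all large `n`. -/
theorem disc_LWord_lower :
    ∃ c > (0 : ℝ), ∃ N : ℕ, ∀ n : ℕ, N ≤ n →
      c * 2 ^ n * Real.log n / n ≤ (disc (LWord n) : ℝ) := by
  refine ⟨1 / 32, by norm_num, 8, fun n hn => ?_⟩
  have hn0 : n ≠ 0 := by omega
  set k := Nat.log 2 n + 2 with hk
  have hlow : 2 ^ k ≤ 4 * n := by
    rw [hk, pow_add]; linarith [Nat.pow_log_le_self 2 hn0]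
  have hhigh : 2 * n < 2 ^ k := by
    have := Nat.lt_pow_succ_log_self one_lt_two n
    rw [hk, pow_succ]; omega
  have hkn : k + 2 ≤ n := by
    by_contra! h
    have h1 : n - 3 ≤ Nat.log 2 n := by omega
    have h2 := (Nat.pow_le_pow_right two_pos h1).trans (Nat.pow_log_le_self 2 hn0)
    obtain ⟨t, rfl⟩ := Nat.exists_eq_add_of_le hn
    rw [show 8 + t - 3 = t + 5 by omega, pow_add] at h2
    have := t.lt_two_pow_self
    omega
  clear_value k
  obtain ⟨m, hm⟩ := Nat.exists_eq_add_of_le hkn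
  have hgood := two_pow_le_two_mul_card (k := k) (m := m) (by omega) (by omega)
  have hdisc := mul_card_le_disc_LWord (k := k) (by omega) m
  rw [← hm] at hdisc
  generalize ((words m).filter (¬ hasZeroRun k ·)).card = g at hgood hdisc
  have hdisc' : (k : ℝ) * g ≤ disc (LWord n) := by exact_mod_cast hdisc
  have hgood' : (2 : ℝ) ^ m ≤ 2 * g := by exact_mod_cast hgood
  have hlow' : (2 : ℝ) ^ k ≤ 4 * n := by exact_mod_cast hlow
  have hlog : Real.log n ≤ k := by
    have h1 : (n : ℝ) ≤ 2 ^ k := by exact_mod_cast (by omega : n ≤ 2 ^ k)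
    have h2 := Real.log_le_log (by positivity) h1
    rw [Real.log_pow] at h2
    nlinarith [Real.log_two_lt_d9, (Nat.cast_nonneg k : (0 : ℝ) ≤ k)]
  have hpow : (2 : ℝ) ^ n = 2 ^ k * 4 * 2 ^ m := by
    rw [hm, pow_add, pow_add]; norm_num
  have hnpos : (0 : ℝ) < n := by positivity
  refine le_trans ?_ hdisc'
  rw [div_le_iff₀ hnpos]
  have hlog0 : 0 ≤ Real.log n := Real.log_natCast_nonneg n
  calc 1 / 32 * 2 ^ n * Real.log n = 1 / 32 * (2 ^ k * 4 * 2 ^ m) * Real.log n := by rw [hpow]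
    _ ≤ 1 / 32 * (4 * n * 4 * (2 * g)) * k := by gcongr
    _ = k * g * n := by ring
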